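/- If every countable product of compact metrizable spaces is compact, then CAC(C,M_le) holds; and CAC(C,M_le) implies that every compact metrizable space is separable. -/

import Mathlib

open TopologicalSpace

/-- CAC(C,M_le): every denumerable family of nonempty compact metrizable spaces has a
choice function (their product is nonempty). -/
def CAC_C_Mle : Prop :=
  ∀ (X : ℕ → Type) [∀ n, TopologicalSpace (X n)],
    (∀ n, Nonempty (X n)) → (∀ n, CompactSpace (X n)) →
    (∀ n, MetrizableSpace (X n)) →
    Nonempty (∀ n, X n)

/-- If every countable product of compact metrizable spaces is compact, then countable families of
nonempty compact metrizable spaces have choice functions: adjoin an isolated point to each space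
and use the finite intersection property in the product. -/
theorem CAC_C_Mle_of_compactSpace_pi
    (h : ∀ (X : ℕ → Type) [∀ n, TopologicalSpace (X n)],
      (∀ n, CompactSpace (X n)) → (∀ n, MetrizableSpace (X n)) → CompactSpace (∀ n, X n)) :
    CAC_C_Mle := by
  intro X _ hne hc hm
  have : CompactSpace (∀ n, X n ⊕ Unit) :=
    h (fun n => X n ⊕ Unit) (fun n => inferInstance) (fun n => inferInstance)
  let F : ℕ → Set (∀ n, X n ⊕ Unit) := fun n => ⋂ m < n, {x | x m ∈ Set.range Sum.inl}
  have hF_closed (n : ℕ) : IsClosed (F n) :=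
    isClosed_biInter fun m _ => isClosed_range_inl.preimage (continuous_apply m)
  have hF_nonempty (n : ℕ) : (F n).Nonempty := by
    induction n with
    | zero => exact ⟨fun _ => Sum.inr (), by simp [F]⟩
    | succ n ih =>
      obtain ⟨x, hx⟩ := ih
      obtain ⟨a⟩ := hne n
      refine ⟨Function.update x n (Sum.inl a), ?_⟩
      simp only [F, Set.mem_iInter, Set.mem_ofPred_eq] at hx ⊢
      intro m hmn
      rcases Nat.lt_succ_iff_lt_or_eq.mp hmn with hlt | rfl
      · simpa [Function.update_of_ne hlt.ne] using hx m hlt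
      · simp
  obtain ⟨x, hx⟩ := IsCompact.nonempty_iInter_of_sequence_nonempty_isCompact_isClosed F
    (fun n => Set.biInter_subset_biInter_left fun _ hk => Nat.lt_succ_of_lt hk)
    hF_nonempty (hF_closed 0).isCompact hF_closed
  have hx_left (n : ℕ) : (x n).isLeft := by
    have := Set.mem_iInter.mp hx (n + 1)
    simp only [F, Set.mem_iInter, Set.mem_ofPred_eq] at this
    obtain ⟨a, ha⟩ := this n n.lt_succ_self
    simp [← ha]
  exact ⟨fun n => (x n).getLeft (hx_left n)⟩

/-- The `k`-tuples forming a finite `ε`-net (with non-strict inequality) form a closed set. -/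
theorem isClosed_setOf_forall_exists_dist_le {Y : Type*} [PseudoMetricSpace Y] (k : ℕ) (ε : ℝ) :
    IsClosed {f : Fin k → Y | ∀ y, ∃ i, dist y (f i) ≤ ε} := by
  simp only [Set.ofPred_forall, Set.ofPred_exists]
  exact isClosed_iInter fun y => isClosed_iUnion_of_finite fun i =>
    isClosed_le (by fun_prop) continuous_const

/-- A compact metric space has a finite `ε`-net, as a tuple, for every `ε > 0`. -/
theorem exists_tuple_forall_exists_dist_le {Y : Type*} [PseudoMetricSpace Y] [CompactSpace Y]
    {ε : ℝ} (hε : 0 < ε) : ∃ k, ∃ f : Fin k → Y, ∀ y, ∃ i, dist y (f i) ≤ ε := by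
  obtain ⟨t, -, ht, hcover⟩ := (isCompact_univ (X := Y)).finite_cover_balls hε
  obtain ⟨k, f, -, rfl⟩ := ht.fin_param
  refine ⟨k, f, fun y => ?_⟩
  obtain ⟨i, hi⟩ : ∃ i, dist y (f i) < ε := by simpa using hcover (Set.mem_univ y)
  exact ⟨i, hi.le⟩

/-- Countable choice for compact metrizable spaces makes compact metrizable spaces separable:
choose, for each `n`, a `1 / (n + 1)`-net from the compact space of such nets of least size. -/
theorem CAC_C_Mle.separableSpace (h : CAC_C_Mle) (Y : Type) [TopologicalSpace Y]
    [CompactSpace Y] [MetrizableSpace Y] : SeparableSpace Y := by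
  classical
  let := metrizableSpaceMetric Y
  have hex (n : ℕ) : ∃ k, ∃ f : Fin k → Y, ∀ y, ∃ i, dist y (f i) ≤ 1 / ((n : ℝ) + 1) :=
    exists_tuple_forall_exists_dist_le Nat.one_div_pos_of_nat
  obtain ⟨c⟩ := h
    (fun n => {f : Fin (Nat.find (hex n)) → Y // ∀ y, ∃ i, dist y (f i) ≤ 1 / ((n : ℝ) + 1)})
    (fun n => nonempty_subtype.mpr (Nat.find_spec (hex n)))
    (fun n => isCompact_iff_compactSpace.mp
      (isClosed_setOf_forall_exists_dist_le _ _).isCompact)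
    (fun n => inferInstance)
  refine ⟨⟨Set.range fun p : Σ n, Fin (Nat.find (hex n)) => (c p.1).1 p.2,
    Set.countable_range _, Metric.dense_iff.mpr fun y r hr => ?_⟩⟩
  obtain ⟨n, hn⟩ := exists_nat_one_div_lt hr
  obtain ⟨i, hi⟩ := (c n).2 y
  exact ⟨_, Metric.mem_ball'.mpr (hi.trans_lt hn), ⟨n, i⟩, rfl⟩

theorem stmt_11 :
    ((∀ (X : ℕ → Type) [∀ n, TopologicalSpace (X n)],
        (∀ n, CompactSpace (X n)) → (∀ n, MetrizableSpace (X n)) →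
        CompactSpace (∀ n, X n)) → CAC_C_Mle) ∧
    (CAC_C_Mle →
      ∀ (Y : Type) [TopologicalSpace Y],
        CompactSpace Y → MetrizableSpace Y → SeparableSpace Y) :=
  ⟨CAC_C_Mle_of_compactSpace_pi, fun h Y _ _ _ => h.separableSpace Y⟩
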